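/- arXiv:1310.1895 — 4 statements merged into one kernel-verified Lean document; each statement's English description precedes it below -/
import Mathlib

section
/- Every 2-cocycle on the n-dimensional cube with coefficients in a commutative group is a coboundary: if ψ is a 2-cochain on the n-cube with values in a (multiplicatively written) commutative group A such that (dψ)(ξ,i,j,k) = 1 for every 3-face (ξ,i,j,k), then there exists a 1-cochain ε with dε = ψ. (This is the combinatorial fact, used for the cube of resolutions of a link diagram, that the commutativity cocycle admits a sign assignment.) -/
/-!
STATEMENT 0: Every 2-cocycle on the n-dimensional cube with coefficients in a
commutative group is a coboundary.

Vertices of the n-cube are functions `ξ : Fin n → Bool`; `ξ^i` is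
`Function.update ξ i true` (defined only when `ξ i = false`).  A 2-cochain is a
function `ψ` on 2-faces `(ξ, i, j)` with `i < j`, `ξ i = ξ j = false`; its
coboundary on a 3-face `(ξ, i, j, k)` is
`ψ(ξ,j,k)·ψ(ξ^i,j,k)⁻¹·ψ(ξ,i,k)⁻¹·ψ(ξ^j,i,k)·ψ(ξ,i,j)·ψ(ξ^k,i,j)⁻¹`.
If this is `1` on every 3-face, then there exists a 1-cochain `ε` with
`dε = ψ`, i.e. `ε(ξ^i,j)·ε(ξ,i)·(ε(ξ^j,i)·ε(ξ,j))⁻¹ = ψ(ξ,i,j)` on every 2-face.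
-/

/-- The vertex `ξ` with all coordinates of index at least `m` reset to `false`. -/
def cubeTruncate {n : ℕ} (ξ : Fin n → Bool) (m : ℕ) : Fin n → Bool :=
  fun k => if (k : ℕ) < m then ξ k else false

theorem cubeTruncate_apply_eq_false {n : ℕ} {ξ : Fin n → Bool} {k : Fin n} (h : ξ k = false)
    (m : ℕ) : cubeTruncate ξ m k = false := by
  simp [cubeTruncate, h]

theorem cubeTruncate_self {n : ℕ} (ξ : Fin n → Bool) : cubeTruncate ξ n = ξ := by
  funext k
  simp [cubeTruncate]

theorem cubeTruncate_update_of_lt {n : ℕ} (ξ : Fin n → Bool) {i : Fin n} {m : ℕ}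
    (h : (i : ℕ) < m) :
    cubeTruncate (Function.update ξ i true) m =
      Function.update (cubeTruncate ξ m) i true := by
  funext k
  by_cases hk : k = i
  · subst hk
    simp [cubeTruncate, h]
  · simp [cubeTruncate, hk]

theorem cubeTruncate_update_of_le {n : ℕ} (ξ : Fin n → Bool) {i : Fin n} {m : ℕ}
    (h : m ≤ (i : ℕ)) :
    cubeTruncate (Function.update ξ i true) m = cubeTruncate ξ m := by
  funext k
  by_cases hk : k = i
  · subst hk
    simp [cubeTruncate, Nat.not_lt.mpr h]
  · simp [cubeTruncate, hk]

theorem cubeTruncate_succ_of_false {n : ℕ} {ξ : Fin n → Bool} {l : Fin n} (h : ξ l = false) :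
    cubeTruncate ξ (l + 1) = cubeTruncate ξ l := by
  funext k
  by_cases hk : k = l
  · subst hk
    simp [cubeTruncate, h]
  · have : (k : ℕ) < l + 1 ↔ (k : ℕ) < l := by
      have := Fin.val_ne_of_ne hk
      omega
    simp [cubeTruncate, this]

theorem cubeTruncate_succ_of_true {n : ℕ} {ξ : Fin n → Bool} {l : Fin n} (h : ξ l = true) :
    cubeTruncate ξ (l + 1) = Function.update (cubeTruncate ξ l) l true := by
  funext k
  by_cases hk : k = l
  · subst hk
    simp [cubeTruncate, h]
  · have : (k : ℕ) < l + 1 ↔ (k : ℕ) < l := by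
      have := Fin.val_ne_of_ne hk
      omega
    simp [cubeTruncate, this, hk]

/-- The primitive of a 2-cocycle that is trivial on the edges `(ξ, i)` with `ξ` vanishing
above `i`. -/
def cubePrimitive {n : ℕ} {A : Type*} [CommGroup A] (ψ : (Fin n → Bool) → Fin n → Fin n → A)
    (ξ : Fin n → Bool) (i : Fin n) : A :=
  ∏ l : Fin n, if i < l ∧ ξ l = true then (ψ (cubeTruncate ξ l) i l)⁻¹ else 1

theorem cube_two_cocycle_is_coboundary
    {n : ℕ} {A : Type*} [CommGroup A]
    (ψ : (Fin n → Bool) → Fin n → Fin n → A)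
    (hψ : ∀ (ξ : Fin n → Bool) (i j k : Fin n),
      i < j → j < k → ξ i = false → ξ j = false → ξ k = false →
      ψ ξ j k * (ψ (Function.update ξ i true) j k)⁻¹ * (ψ ξ i k)⁻¹ *
        ψ (Function.update ξ j true) i k * ψ ξ i j *
        (ψ (Function.update ξ k true) i j)⁻¹ = 1) :
    ∃ ε : (Fin n → Bool) → Fin n → A,
      ∀ (ξ : Fin n → Bool) (i j : Fin n), i < j → ξ i = false → ξ j = false →
        ε (Function.update ξ i true) j * ε ξ i *
          (ε (Function.update ξ j true) i * ε ξ j)⁻¹ = ψ ξ i j := by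
  refine ⟨cubePrimitive ψ, fun ξ i j hij hi hj => ?_⟩
  set g : ℕ → A := fun m => ψ (cubeTruncate ξ (max m j)) i j with hg
  have telescope : ψ ξ i j =
      ∏ l : Fin n, (if l = j then g 0 else 1) * (g (l + 1) / g l) := by
    rw [Finset.prod_mul_distrib, Finset.prod_ite_eq' Finset.univ j (fun _ => g 0),
      if_pos (Finset.mem_univ j), ← Finset.prod_range (fun m => g (m + 1) / g m),
      Finset.prod_range_div, mul_div_cancel]
    simp only [hg]
    rw [max_eq_left j.isLt.le, cubeTruncate_self]
  rw [telescope]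
  simp only [cubePrimitive]
  rw [← Finset.prod_mul_distrib, ← Finset.prod_mul_distrib, ← Finset.prod_inv_distrib,
    ← Finset.prod_mul_distrib]
  refine Finset.prod_congr rfl fun l _ => ?_
  simp only [hg]
  rcases lt_trichotomy l j with hlj | rfl | hjl
  · have hlj' : (l : ℕ) < j := hlj
    rw [max_eq_right (Nat.succ_le_of_lt hlj'), max_eq_right hlj'.le,
      cubeTruncate_update_of_le ξ hlj'.le]
    simp [hlj.ne, hlj.not_gt]
  · rw [max_eq_left (Nat.le_succ _), cubeTruncate_succ_of_false hj,
      cubeTruncate_update_of_le ξ le_rfl]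
    simp [hij, hj]
  · have hil := hij.trans hjl
    have hjl' : (j : ℕ) < l := hjl
    have hil' : (i : ℕ) < l := hil
    rw [max_eq_left (hjl'.le.trans (Nat.le_succ _)), max_eq_left hjl'.le,
      cubeTruncate_update_of_lt ξ hjl', cubeTruncate_update_of_lt ξ hil']
    cases hl : ξ l with
    | false => simp [cubeTruncate_succ_of_false hl, hil.ne', hjl.ne', hl]
    | true =>
      have h := hψ (cubeTruncate ξ l) i j l hij hjl (cubeTruncate_apply_eq_false hi _)
        (cubeTruncate_apply_eq_false hj _) (by simp [cubeTruncate])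
      rw [cubeTruncate_succ_of_true hl]
      simp only [Function.update_of_ne hil.ne', Function.update_of_ne hjl.ne', hl, hil, hjl,
        hjl.ne', and_self, if_true, if_false, one_mul]
      rw [← mul_inv_eq_one, ← h]
      simp only [div_eq_mul_inv, mul_inv, inv_inv]
      ac_rfl
end

section
/- If ε and ε′ are two 1-cochains on the n-dimensional cube with values in a commutative group A such that dε = dε′ (i.e. they have the same coboundary on every 2-face), then there exists a 0-cochain η such that ε′(ξ,i) = η(ξ^i)·η(ξ)⁻¹·ε(ξ,i) for every edge (ξ,i). (This is the combinatorial content of the lemma that any two sign assignments for a cube of resolutions yield isomorphic corrected cubes.) -/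
/-!
STATEMENT 1: Two 1-cochains on the n-cube with values in a commutative group
that have the same coboundary on every 2-face differ by the coboundary of a
0-cochain: `ε′(ξ,i) = η(ξ^i)·η(ξ)⁻¹·ε(ξ,i)` for every edge `(ξ,i)`.
Here `ξ^i` denotes `Function.update ξ i true` (for an edge, `ξ i = false`),
and the coboundary of a 1-cochain on a 2-face `(ξ,i,j)` with `i < j` is
`ε(ξ^i,j)·ε(ξ,i)·(ε(ξ^j,i)·ε(ξ,j))⁻¹`.
-/

/-- A closed multiplicative 1-cochain on the cube is exact along any finite set of directions. -/
theorem exists_potential_of_closed {ι A : Type*} [DecidableEq ι] [CommGroup A]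
    (δ : (ι → Bool) → ι → A)
    (hδ : ∀ (ξ : ι → Bool) (i j : ι), i ≠ j → ξ i = false → ξ j = false →
      δ (Function.update ξ i true) j * δ ξ i = δ (Function.update ξ j true) i * δ ξ j)
    (s : Finset ι) :
    ∃ η : (ι → Bool) → A, ∀ (ξ : ι → Bool), ∀ i ∈ s, ξ i = false →
      η (Function.update ξ i true) = δ ξ i * η ξ := by
  induction s using Finset.induction_on with
  | empty => exact ⟨1, by simp⟩
  | insert j s hj ih =>
    obtain ⟨η, hη⟩ := ih
    refine ⟨fun ξ => if ξ j = true then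
      δ (Function.update ξ j false) j * η (Function.update ξ j false) else η ξ, ?_⟩
    intro ξ i hi hξi
    by_cases hij : i = j
    · subst hij
      have h_self : Function.update ξ i false = ξ := by rw [← hξi, Function.update_eq_self]
      simp [hξi, h_self]
    · have his : i ∈ s := (Finset.mem_insert.mp hi).resolve_left hij
      by_cases hξj : ξ j = true
      · have h_self : Function.update (Function.update ξ j false) j true = ξ := by
          rw [Function.update_idem, ← hξj, Function.update_eq_self]
        have hζi : Function.update ξ j false i = false := by
          rw [Function.update_of_ne hij, hξi]
        have h_face := hδ (Function.update ξ j false) i j hij hζi (by simp)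
        rw [h_self] at h_face
        simp only [Function.update_of_ne (Ne.symm hij), hξj, if_true]
        rw [Function.update_comm hij, hη _ i his hζi, ← mul_assoc, h_face, mul_assoc]
      · simp only [Function.update_of_ne (Ne.symm hij), hξj]
        exact hη ξ i his hξi

theorem sign_assignments_differ_by_coboundary
    {n : ℕ} {A : Type*} [CommGroup A]
    (ε ε' : (Fin n → Bool) → Fin n → A)
    (h : ∀ (ξ : Fin n → Bool) (i j : Fin n), i < j → ξ i = false → ξ j = false →
      ε (Function.update ξ i true) j * ε ξ i *
          (ε (Function.update ξ j true) i * ε ξ j)⁻¹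
        = ε' (Function.update ξ i true) j * ε' ξ i *
            (ε' (Function.update ξ j true) i * ε' ξ j)⁻¹) :
    ∃ η : (Fin n → Bool) → A,
      ∀ (ξ : Fin n → Bool) (i : Fin n), ξ i = false →
        ε' ξ i = η (Function.update ξ i true) * (η ξ)⁻¹ * ε ξ i := by
  have hδ : ∀ (ξ : Fin n → Bool) (i j : Fin n), i < j → ξ i = false → ξ j = false →
      ε' (Function.update ξ i true) j / ε (Function.update ξ i true) j * (ε' ξ i / ε ξ i) =
        ε' (Function.update ξ j true) i / ε (Function.update ξ j true) i *
          (ε' ξ j / ε ξ j) := by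
    intro ξ i j hij hi hj
    have h_face := h ξ i j hij hi hj
    rw [← div_eq_mul_inv, ← div_eq_mul_inv, div_eq_div_iff_mul_eq_mul] at h_face
    rw [div_mul_div_comm, div_mul_div_comm, div_eq_div_iff_mul_eq_mul]
    rw [← h_face, mul_comm]
  obtain ⟨η, hη⟩ := exists_potential_of_closed (fun ξ i => ε' ξ i / ε ξ i)
    (fun ξ i j hij hi hj => hij.lt_or_gt.elim (fun hlt => hδ ξ i j hlt hi hj)
      fun hgt => (hδ ξ j i hgt hj hi).symm) Finset.univ
  refine ⟨η, fun ξ i hi => ?_⟩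
  rw [hη ξ i (Finset.mem_univ i) hi]
  simp
end

section
/- Naturality of the graded braiding: let R be a commutative ring, G an additive commutative group, and λ : G × G → Rˣ multiplicative in each variable and satisfying λ(u,v)·λ(v,u) = 1 for all u,v ∈ G. Let M, M′, N, N′ be G-graded R-modules, f : M → M′ homogeneous of degree df, and g : N → N′ homogeneous of degree dg. Let σ : M⊗N → N⊗M be the linear map with σ(m⊗n) = λ(i,j) • (n⊗m) for m ∈ M_i, n ∈ N_j, and σ′ : M′⊗N′ → N′⊗M′ the analogous map. Let F : M⊗N → M′⊗N′ be the λ-twisted tensor product of f and g (so F(m⊗n) = λ(dg,i)•(f m ⊗ g n) for m ∈ M_i), and G₀ : N⊗M → N′⊗M′ the λ-twisted tensor product of g and f (so G₀(n⊗m) = λ(df,j)•(g n ⊗ f m) for n ∈ N_j). Then σ′ ∘ F = λ(df, dg) • (G₀ ∘ σ). -/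
open TensorProduct

/-- Linear maps out of `M ⊗ N` agree if they agree on the pure tensors of elements taken from
families of submodules spanning `M` and `N`. -/
theorem TensorProduct.ext_of_iSup_eq_top {R M N P ι κ : Type*} [CommSemiring R]
    [AddCommMonoid M] [Module R M] [AddCommMonoid N] [Module R N] [AddCommMonoid P] [Module R P]
    {p : ι → Submodule R M} {q : κ → Submodule R N} (hp : iSup p = ⊤) (hq : iSup q = ⊤)
    {φ ψ : M ⊗[R] N →ₗ[R] P}
    (h : ∀ i j, ∀ m ∈ p i, ∀ n ∈ q j, φ (m ⊗ₜ[R] n) = ψ (m ⊗ₜ[R] n)) : φ = ψ := by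
  refine TensorProduct.ext' fun m n => ?_
  have hm : m ∈ iSup p := hp ▸ Submodule.mem_top
  have hn : n ∈ iSup q := hq ▸ Submodule.mem_top
  induction hm using Submodule.iSup_induction' with
  | zero => simp
  | add x y _ _ hx hy => simp [TensorProduct.add_tmul, hx, hy]
  | mem i m hm =>
    induction hn using Submodule.iSup_induction' with
    | zero => simp
    | add x y _ _ hx hy => simp [TensorProduct.tmul_add, hx, hy]
    | mem j n hn => exact h i j m hm n hn

/-!
STATEMENT 7: Naturality of the graded braiding: for homogeneous maps
`f : M → M′` (degree `df`) and `g : N → N′` (degree `dg`), with `σ, σ′` the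
λ-twisted braidings (`σ(m⊗n) = λ(deg m, deg n) • (n⊗m)` on homogeneous
elements), `F` the λ-twisted tensor product of `(f, g)` and `G₀` that of
`(g, f)`, one has `σ′ ∘ F = λ(df, dg) • (G₀ ∘ σ)`.  Here `λ : G × G → Rˣ` is
multiplicative in each variable and satisfies `λ(u,v)·λ(v,u) = 1`.
-/

theorem graded_braiding_naturality
    {R : Type*} [CommRing R] {G : Type*} [AddCommGroup G] [DecidableEq G]
    (lam : G → G → Rˣ)
    (hlam₁ : ∀ u u' v : G, lam (u + u') v = lam u v * lam u' v)
    (hlam₂ : ∀ u v v' : G, lam u (v + v') = lam u v * lam u v')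
    (hanti : ∀ u v : G, lam u v * lam v u = 1)
    {M M' N N' : Type*}
    [AddCommGroup M] [Module R M] [AddCommGroup M'] [Module R M']
    [AddCommGroup N] [Module R N] [AddCommGroup N'] [Module R N']
    (𝓜 : G → Submodule R M) (𝓜' : G → Submodule R M')
    (𝓝 : G → Submodule R N) (𝓝' : G → Submodule R N')
    (hMint : DirectSum.IsInternal 𝓜) (hM'int : DirectSum.IsInternal 𝓜')
    (hNint : DirectSum.IsInternal 𝓝) (hN'int : DirectSum.IsInternal 𝓝')
    (f : M →ₗ[R] M') (g : N →ₗ[R] N') (df dg : G)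
    (hf : ∀ i : G, ∀ m ∈ 𝓜 i, f m ∈ 𝓜' (i + df))
    (hg : ∀ j : G, ∀ n ∈ 𝓝 j, g n ∈ 𝓝' (j + dg))
    (σ : M ⊗[R] N →ₗ[R] N ⊗[R] M) (σ' : M' ⊗[R] N' →ₗ[R] N' ⊗[R] M')
    (F : M ⊗[R] N →ₗ[R] M' ⊗[R] N') (G₀ : N ⊗[R] M →ₗ[R] N' ⊗[R] M')
    (hσ : ∀ i j : G, ∀ m ∈ 𝓜 i, ∀ n ∈ 𝓝 j,
      σ (m ⊗ₜ[R] n) = (lam i j : R) • (n ⊗ₜ[R] m))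
    (hσ' : ∀ i j : G, ∀ m ∈ 𝓜' i, ∀ n ∈ 𝓝' j,
      σ' (m ⊗ₜ[R] n) = (lam i j : R) • (n ⊗ₜ[R] m))
    (hF : ∀ i : G, ∀ m ∈ 𝓜 i, ∀ n : N,
      F (m ⊗ₜ[R] n) = (lam dg i : R) • (f m ⊗ₜ[R] g n))
    (hG : ∀ j : G, ∀ n ∈ 𝓝 j, ∀ m : M,
      G₀ (n ⊗ₜ[R] m) = (lam df j : R) • (g n ⊗ₜ[R] f m)) :
    σ'.comp F = (lam df dg : R) • (G₀.comp σ) := by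
  refine TensorProduct.ext_of_iSup_eq_top hMint.submodule_iSup_eq_top
    hNint.submodule_iSup_eq_top fun i j m hm n hn => ?_
  have hscalar : lam dg i * lam (i + df) (j + dg) = lam df dg * (lam i j * lam df j) := by
    rw [hlam₁, hlam₂, hlam₂]
    calc lam dg i * (lam i j * lam i dg * (lam df j * lam df dg))
        = lam dg i * lam i dg * (lam df dg * (lam i j * lam df j)) := by
          simp only [mul_comm, mul_left_comm]
      _ = lam df dg * (lam i j * lam df j) := by rw [hanti, one_mul]
  simp only [LinearMap.comp_apply, LinearMap.smul_apply, hF i m hm, hσ i j m hm n hn, map_smul,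
    hσ' _ _ _ (hf i m hm) _ (hg j n hn), hG j n hn, smul_smul, ← Units.val_mul, hscalar]
end

section
/- The covering Khovanov algebra is a chronological Frobenius system: with the covering algebra data (R, X, Y, Z, A, v₊, v₋, η, ε, μ, Δ, σ and the twisted structure maps μ⊗id, id⊗′μ, Δ⊗id, id⊗′Δ, ε⊗id as in the context), the following hold: (a) twisted associativity: μ ∘ (μ⊗id) = X • (μ ∘ (id⊗′μ)) as maps A⊗A⊗A → A; (b) twisted coassociativity: (Δ⊗id) ∘ Δ = Y • ((id⊗′Δ) ∘ Δ) as maps A → A⊗A⊗A; (c) unit and counit: μ(v₊ ⊗ a) = a for all a ∈ A, and (ε⊗id) ∘ Δ = id_A; (d) twisted commutativity and cocommutativity: μ ∘ σ = X • μ and σ ∘ Δ = Y • Δ; (e) the Frobenius relation: (μ⊗id) ∘ (id⊗′Δ) = Z • (Δ ∘ μ) = (id⊗′μ) ∘ (Δ⊗id) as maps A⊗A → A⊗A. -/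
open TensorProduct

/-!
STATEMENT 10: The covering Khovanov algebra is a chronological Frobenius system.

`A = R × R` is free on `v₊ = (1,0)`, `v₋ = (0,1)`; the structure maps
`η, ε, μ, Δ, σ` and the twisted maps `μ⊗id`, `id⊗′μ`, `Δ⊗id`, `id⊗′Δ`, `ε⊗id`
are characterised by their values on (pure tensors of) basis elements as in the
paper.  The conclusions are: (a) twisted associativity, (b) twisted
coassociativity, (c) unit and counit axioms, (d) twisted (co)commutativity,
(e) the Frobenius relation.
-/

/-- Linear maps out of `R × R` agree if they agree on the two standard basis vectors. -/
theorem LinearMap.prod_ext_basis {R M : Type*} [CommSemiring R] [AddCommMonoid M] [Module R M]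
    {f g : R × R →ₗ[R] M} (hp : f (1, 0) = g (1, 0)) (hm : f (0, 1) = g (0, 1)) : f = g := by
  ext
  · simpa using hp
  · simpa using hm

/-- Linear maps out of `(R × R) ⊗ (R × R)` agree if they agree on tensors of standard basis
vectors. -/
theorem TensorProduct.ext_prod_basis_two {R N : Type*} [CommSemiring R]
    [AddCommMonoid N] [Module R N] {f g : (R × R) ⊗[R] (R × R) →ₗ[R] N}
    (hpp : f ((1, 0) ⊗ₜ (1, 0)) = g ((1, 0) ⊗ₜ (1, 0)))
    (hpm : f ((1, 0) ⊗ₜ (0, 1)) = g ((1, 0) ⊗ₜ (0, 1)))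
    (hmp : f ((0, 1) ⊗ₜ (1, 0)) = g ((0, 1) ⊗ₜ (1, 0)))
    (hmm : f ((0, 1) ⊗ₜ (0, 1)) = g ((0, 1) ⊗ₜ (0, 1))) : f = g :=
  TensorProduct.ext <| LinearMap.prod_ext_basis
    (LinearMap.prod_ext_basis hpp hpm) (LinearMap.prod_ext_basis hmp hmm)

/-- Linear maps out of the triple tensor power of `R × R` agree if they agree on tensors of
standard basis vectors. -/
theorem TensorProduct.ext_prod_basis_three {R N : Type*} [CommSemiring R]
    [AddCommMonoid N] [Module R N] {f g : ((R × R) ⊗[R] (R × R)) ⊗[R] (R × R) →ₗ[R] N}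
    (h : ∀ x y z : R × R, (x = (1, 0) ∨ x = (0, 1)) → (y = (1, 0) ∨ y = (0, 1)) →
      (z = (1, 0) ∨ z = (0, 1)) → f ((x ⊗ₜ y) ⊗ₜ z) = g ((x ⊗ₜ y) ⊗ₜ z)) : f = g := by
  refine TensorProduct.ext <| TensorProduct.ext_prod_basis_two ?_ ?_ ?_ ?_ <;>
    exact LinearMap.prod_ext_basis (h _ _ _ (by simp) (by simp) (by simp))
      (h _ _ _ (by simp) (by simp) (by simp))

theorem covering_algebra_is_chronological_frobenius
    {R : Type*} [CommRing R] (X Y Z Zi : R)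
    (hX : X * X = 1) (hY : Y * Y = 1) (hZ : Z * Zi = 1)
    (η : R →ₗ[R] (R × R)) (ε : (R × R) →ₗ[R] R)
    (μ : (R × R) ⊗[R] (R × R) →ₗ[R] (R × R))
    (Δ : (R × R) →ₗ[R] (R × R) ⊗[R] (R × R))
    (σ : (R × R) ⊗[R] (R × R) →ₗ[R] (R × R) ⊗[R] (R × R))
    (μid : ((R × R) ⊗[R] (R × R)) ⊗[R] (R × R) →ₗ[R] (R × R) ⊗[R] (R × R))
    (idμ : ((R × R) ⊗[R] (R × R)) ⊗[R] (R × R) →ₗ[R] (R × R) ⊗[R] (R × R))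
    (Δid : (R × R) ⊗[R] (R × R) →ₗ[R] ((R × R) ⊗[R] (R × R)) ⊗[R] (R × R))
    (idΔ : (R × R) ⊗[R] (R × R) →ₗ[R] ((R × R) ⊗[R] (R × R)) ⊗[R] (R × R))
    (εid : (R × R) ⊗[R] (R × R) →ₗ[R] (R × R))
    (hη : ∀ r : R, η r = r • ((1, 0) : R × R))
    (hεp : ε ((1, 0) : R × R) = 0) (hεm : ε ((0, 1) : R × R) = 1)
    (hμ₁ : μ (((1, 0) : R × R) ⊗ₜ[R] ((1, 0) : R × R)) = ((1, 0) : R × R))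
    (hμ₂ : μ (((1, 0) : R × R) ⊗ₜ[R] ((0, 1) : R × R)) = ((0, 1) : R × R))
    (hμ₃ : μ (((0, 1) : R × R) ⊗ₜ[R] ((1, 0) : R × R)) = (X * Z) • ((0, 1) : R × R))
    (hμ₄ : μ (((0, 1) : R × R) ⊗ₜ[R] ((0, 1) : R × R)) = 0)
    (hΔp : Δ ((1, 0) : R × R)
      = ((0, 1) : R × R) ⊗ₜ[R] ((1, 0) : R × R)
        + (Y * Z) • (((1, 0) : R × R) ⊗ₜ[R] ((0, 1) : R × R)))
    (hΔm : Δ ((0, 1) : R × R) = ((0, 1) : R × R) ⊗ₜ[R] ((0, 1) : R × R))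
    (hσ₁ : σ (((1, 0) : R × R) ⊗ₜ[R] ((1, 0) : R × R))
      = X • (((1, 0) : R × R) ⊗ₜ[R] ((1, 0) : R × R)))
    (hσ₂ : σ (((1, 0) : R × R) ⊗ₜ[R] ((0, 1) : R × R))
      = Zi • (((0, 1) : R × R) ⊗ₜ[R] ((1, 0) : R × R)))
    (hσ₃ : σ (((0, 1) : R × R) ⊗ₜ[R] ((1, 0) : R × R))
      = Z • (((1, 0) : R × R) ⊗ₜ[R] ((0, 1) : R × R)))
    (hσ₄ : σ (((0, 1) : R × R) ⊗ₜ[R] ((0, 1) : R × R))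
      = Y • (((0, 1) : R × R) ⊗ₜ[R] ((0, 1) : R × R)))
    (hμid : ∀ x y z : R × R, μid ((x ⊗ₜ[R] y) ⊗ₜ[R] z) = μ (x ⊗ₜ[R] y) ⊗ₜ[R] z)
    (hidμp : ∀ y z : R × R,
      idμ ((((1, 0) : R × R) ⊗ₜ[R] y) ⊗ₜ[R] z)
        = X • (((1, 0) : R × R) ⊗ₜ[R] μ (y ⊗ₜ[R] z)))
    (hidμm : ∀ y z : R × R,
      idμ ((((0, 1) : R × R) ⊗ₜ[R] y) ⊗ₜ[R] z)
        = Z • (((0, 1) : R × R) ⊗ₜ[R] μ (y ⊗ₜ[R] z)))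
    (hΔid : ∀ m n : R × R, Δid (m ⊗ₜ[R] n) = Δ m ⊗ₜ[R] n)
    (hidΔp : ∀ n : R × R,
      idΔ (((1, 0) : R × R) ⊗ₜ[R] n)
        = Z • ((TensorProduct.assoc R (R × R) (R × R) (R × R)).symm
            (((1, 0) : R × R) ⊗ₜ[R] Δ n)))
    (hidΔm : ∀ n : R × R,
      idΔ (((0, 1) : R × R) ⊗ₜ[R] n)
        = Y • ((TensorProduct.assoc R (R × R) (R × R) (R × R)).symm
            (((0, 1) : R × R) ⊗ₜ[R] Δ n)))
    (hεid : ∀ m n : R × R, εid (m ⊗ₜ[R] n) = ε m • n) :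
    -- (a) twisted associativity
    (μ.comp μid = X • (μ.comp idμ)) ∧
    -- (b) twisted coassociativity
    (Δid.comp Δ = Y • (idΔ.comp Δ)) ∧
    -- (c) unit and counit
    ((∀ a : R × R, μ (((1, 0) : R × R) ⊗ₜ[R] a) = a) ∧ εid.comp Δ = LinearMap.id) ∧
    -- (d) twisted commutativity and cocommutativity
    ((μ.comp σ = X • μ) ∧ (σ.comp Δ = Y • Δ)) ∧
    -- (e) the Frobenius relation
    ((μid.comp idΔ = Z • (Δ.comp μ)) ∧ (Z • (Δ.comp μ) = idμ.comp Δid)) := by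
  have hμp (a : R × R) : μ ((1, 0) ⊗ₜ[R] a) = a := by
    have h : μ.comp (TensorProduct.mk R (R × R) (R × R) (1, 0)) = LinearMap.id :=
      LinearMap.prod_ext_basis hμ₁ hμ₂
    exact LinearMap.congr_fun h a
  refine ⟨TensorProduct.ext_prod_basis_three ?_, LinearMap.prod_ext_basis ?_ ?_,
    ⟨hμp, LinearMap.prod_ext_basis ?_ ?_⟩,
    ⟨TensorProduct.ext_prod_basis_two ?_ ?_ ?_ ?_, LinearMap.prod_ext_basis ?_ ?_⟩,
    TensorProduct.ext_prod_basis_two ?_ ?_ ?_ ?_, TensorProduct.ext_prod_basis_two ?_ ?_ ?_ ?_⟩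
  on_goal 1 => rintro _ _ _ (rfl | rfl) (rfl | rfl) (rfl | rfl)
  all_goals
    simp only [LinearMap.comp_apply, LinearMap.smul_apply, LinearMap.id_apply, map_add, map_smul,
      map_zero, TensorProduct.add_tmul, TensorProduct.tmul_add, ← TensorProduct.smul_tmul',
      TensorProduct.tmul_smul, TensorProduct.zero_tmul, TensorProduct.tmul_zero, smul_zero,
      zero_smul, TensorProduct.assoc_symm_tmul, hεp, hεm, hμ₁, hμ₂, hμ₃, hμ₄, hΔp, hΔm, hσ₁, hσ₂,
      hσ₃, hσ₄, hμid, hidμp, hidμm, hΔid, hidΔp, hidΔm, hεid]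
  all_goals
    clear * - hX hY hZ
    generalize ((1, 0) : R × R) = p, ((0, 1) : R × R) = m
    match_scalars <;> grind
end
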